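/- Conventions: the dimension of a subset of a real vector space is the dimension of its affine span, with $\dim\emptyset=-1$; a simplex is the convex hull of a finite affinely independent set. Let $\pi:\mathbb{R}^d\times\mathbb{R}\to\mathbb{R}^d$ be the projection onto the first factor. For a polytope $Q\subseteq\mathbb{R}^d\times\mathbb{R}$, a lower facet of $Q$ is a set of the form $F=\{z\in Q : u(z)=\min_Q u\}$, where $u$ is a linear functional on $\mathbb{R}^d\times\mathbb{R}$ with $u(0,1)>0$, such that $\dim F=\dim\operatorname{conv}(\pi(Q))$. For a finite set $L\subseteq\mathbb{Q}^d$ and a function $w:L\to\mathbb{Q}$, put $Q_w:=\operatorname{conv}\{(x,w(x)) : x\in L\}\subseteq\mathbb{R}^d\times\mathbb{R}$. Let $L_0\subseteq\mathbb{Q}^d$ be a finite set, let $v\in\mathbb{Q}^d$ be a point with $\dim\operatorname{conv}(L_0\cup\{v\})=\dim\operatorname{conv}(L_0)$ (so that $L_0$ is nonempty), and let $w_0:L_0\to\mathbb{Q}_{\ge 0}$ be a weight function such that every lower facet of $Q_{w_0}$ is a simplex. Then there exist $W\in\mathbb{Q}_{\ge 0}$ and a weight function $w_1$ on $L_0\cup\{v\}$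 with $w_1(x)=w_0(x)$ for all $x\in L_0$ and $w_1(v)=W$ (so necessarily $W=w_0(v)$ if $v\in L_0$), such that every lower facet of $Q_{w_1}$ is a simplex and every lower facet of $Q_{w_0}$ is also a lower facet of $Q_{w_1}$. -/

import Mathlib

/-- Embedding of rational vectors into real vectors. -/
def rk {d : ℕ} (x : Fin d → ℚ) : Fin d → ℝ := fun i => (x i : ℝ)

open Classical in
/-- Dimension of a subset of a real vector space: the dimension of its affine span, with the
convention `dim ∅ = -1`. -/
noncomputable def setDim {V : Type*} [AddCommGroup V] [Module ℝ V] (s : Set V) : ℤ :=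
  if s = ∅ then -1 else (Module.finrank ℝ (affineSpan ℝ s).direction : ℤ)

/-- A linear functional on `ℝ^d × ℝ` is lower if it is positive on `(0, 1)`. -/
def IsLowerFn {d : ℕ} (u : ((Fin d → ℝ) × ℝ) →ₗ[ℝ] ℝ) : Prop := 0 < u (0, 1)

/-- The exposed face of `Q` at the functional `u`: the set of minimizers of `u` on `Q`. -/
def lowerFace {d : ℕ} (Q : Set ((Fin d → ℝ) × ℝ)) (u : ((Fin d → ℝ) × ℝ) →ₗ[ℝ] ℝ) :
    Set ((Fin d → ℝ) × ℝ) := {z ∈ Q | ∀ y ∈ Q, u z ≤ u y}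

/-- A lower facet of `Q`: an exposed face of `Q` at a lower functional whose dimension
equals the dimension of the convex hull of the projection of `Q` to `ℝ^d`. -/
def IsLowerFacet {d : ℕ} (Q F : Set ((Fin d → ℝ) × ℝ)) : Prop :=
  ∃ u, IsLowerFn u ∧ F = lowerFace Q u ∧
    setDim F = setDim (convexHull ℝ (Prod.fst '' Q))

/-- A simplex: the convex hull of an affinely independent finite set. -/
def IsSimplex {V : Type*} [AddCommGroup V] [Module ℝ V] (s : Set V) : Prop :=
  ∃ t : Finset V, AffineIndependent ℝ (fun x : (t : Set V) => x.1) ∧ s = convexHull ℝ (t : Set V)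

/-- The lifted polytope `Q_w` of a finite set `L` of rational points with rational weights;
only the values of `w` on `L` matter. -/
noncomputable def liftQ {d : ℕ} (L : Finset (Fin d → ℚ)) (w : (Fin d → ℚ) → ℚ) :
    Set ((Fin d → ℝ) × ℝ) :=
  convexHull ℝ ((fun x => (rk x, (w x : ℝ))) '' (L : Set (Fin d → ℚ)))

section LowerFaces

variable {d : ℕ}

lemma lowerFace_subset (Q : Set ((Fin d → ℝ) × ℝ)) (u : ((Fin d → ℝ) × ℝ) →ₗ[ℝ] ℝ) :
    lowerFace Q u ⊆ Q := fun _ hz => hz.1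

lemma lowerFace_finset_nonempty {T : Finset ((Fin d → ℝ) × ℝ)} (hT : T.Nonempty)
    (u : ((Fin d → ℝ) × ℝ) →ₗ[ℝ] ℝ) : (lowerFace (T : Set _) u).Nonempty := by
  obtain ⟨z, hz, hmin⟩ := T.exists_min_image u hT
  exact ⟨z, hz, hmin⟩

lemma le_of_mem_convexHull {V : Type*} [AddCommGroup V] [Module ℝ V] {s : Set V} {f : V →ₗ[ℝ] ℝ}
    {m : ℝ} (h : ∀ z ∈ s, m ≤ f z) {z : V} (hz : z ∈ convexHull ℝ s) : m ≤ f z :=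
  convexHull_min (t := {z | m ≤ f z}) h (convex_halfSpace_ge f.isLinear m) hz

lemma mem_lowerFace_convexHull_iff {s : Set ((Fin d → ℝ) × ℝ)} {u : ((Fin d → ℝ) × ℝ) →ₗ[ℝ] ℝ}
    {z : (Fin d → ℝ) × ℝ} :
    z ∈ lowerFace (convexHull ℝ s) u ↔ z ∈ convexHull ℝ s ∧ ∀ y ∈ s, u z ≤ u y :=
  ⟨fun h => ⟨h.1, fun y hy => h.2 y (subset_convexHull ℝ s hy)⟩,
    fun h => ⟨h.1, fun _ hy => le_of_mem_convexHull h.2 hy⟩⟩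

lemma convex_lowerFace_convexHull (s : Set ((Fin d → ℝ) × ℝ)) (u : ((Fin d → ℝ) × ℝ) →ₗ[ℝ] ℝ) :
    Convex ℝ (lowerFace (convexHull ℝ s) u) := by
  have : lowerFace (convexHull ℝ s) u =
      convexHull ℝ s ∩ ⋂ y ∈ s, {z | u z ≤ u y} := by
    ext z
    simp [mem_lowerFace_convexHull_iff]
  rw [this]
  exact (convex_convexHull ℝ s).inter
    (convex_iInter₂ fun y _ => convex_halfSpace_le u.isLinear (u y))

/-- An exposed face of a polytope is spanned by the generators it contains. -/
lemma lowerFace_convexHull (T : Finset ((Fin d → ℝ) × ℝ)) (u : ((Fin d → ℝ) × ℝ) →ₗ[ℝ] ℝ) :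
    lowerFace (convexHull ℝ (T : Set _)) u = convexHull ℝ (lowerFace (T : Set _) u) := by
  apply Set.Subset.antisymm
  · intro z hz
    rw [mem_lowerFace_convexHull_iff] at hz
    obtain ⟨hzT, hzmin⟩ := hz
    obtain ⟨w, hw0, hw1, hwz⟩ := Finset.mem_convexHull.1 hzT
    have huz : u z = ∑ i ∈ T, w i * u i := by
      rw [← hwz, Finset.centerMass_eq_of_sum_1 _ _ hw1]
      simp
    have hsum : ∑ i ∈ T, w i * (u i - u z) = 0 := by
      simp only [mul_sub, Finset.sum_sub_distrib, ← Finset.sum_mul, hw1]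
      linarith
    have hzero := (Finset.sum_eq_zero_iff_of_nonneg fun i hi =>
      mul_nonneg (hw0 i hi) (sub_nonneg.2 (hzmin i hi))).1 hsum
    rw [← hwz, ← Finset.centerMass_filter_ne_zero]
    refine Finset.centerMass_mem_convexHull _ (fun i hi => hw0 i (Finset.mem_filter.1 hi).1) ?_ ?_
    · rw [Finset.sum_filter_ne_zero, hw1]
      exact one_pos
    · intro i hi
      obtain ⟨hiT, hwi⟩ := Finset.mem_filter.1 hi
      have h : u i = u z := sub_eq_zero.1 ((mul_eq_zero.1 (hzero i hiT)).resolve_left hwi)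
      exact ⟨hiT, fun y hy => by rw [id, h]; exact hzmin y hy⟩
  · refine convexHull_min (fun z hz => ?_) (convex_lowerFace_convexHull _ u)
    exact mem_lowerFace_convexHull_iff.2 ⟨subset_convexHull ℝ _ hz.1, hz.2⟩

/-- An exposed face contained in a larger face is exposed in it by the same functional. -/
lemma lowerFace_eq_of_subset {Q G : Set ((Fin d → ℝ) × ℝ)} {u : ((Fin d → ℝ) × ℝ) →ₗ[ℝ] ℝ}
    (hne : (lowerFace Q u).Nonempty) (hG : G ⊆ Q) (hF : lowerFace Q u ⊆ G) :
    lowerFace Q u = lowerFace G u := by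
  obtain ⟨z₀, hz₀⟩ := hne
  ext z
  exact ⟨fun h => ⟨hF h, fun y hy => h.2 y (hG hy)⟩,
    fun h => ⟨hG h.1, fun y hy => (h.2 z₀ (hF hz₀)).trans (hz₀.2 y hy)⟩⟩

lemma setDim_convexHull {V : Type*} [AddCommGroup V] [Module ℝ V] {s : Set V} (hs : s.Nonempty) :
    setDim (convexHull ℝ s) = (Module.finrank ℝ (vectorSpan ℝ s) : ℤ) := by
  rw [setDim, if_neg (convexHull_nonempty_iff.2 hs).ne_empty, affineSpan_convexHull,
    direction_affineSpan]

/-- Tilting a lower functional about the face it exposes until a further point is reached. -/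
lemma exists_lowerFace_ssubset {T : Finset ((Fin d → ℝ) × ℝ)} {u : ((Fin d → ℝ) × ℝ) →ₗ[ℝ] ℝ}
    (hu : IsLowerFn u) {l : (Fin d → ℝ) →ₗ[ℝ] ℝ} {c : ℝ}
    (hl : ∀ z ∈ lowerFace (T : Set _) u, l z.1 = c) (hc : ∃ y ∈ T, l y.1 < c) :
    ∃ u', IsLowerFn u' ∧ lowerFace (T : Set _) u ⊂ lowerFace (T : Set _) u' := by
  classical
  obtain ⟨y, hyT, hy⟩ := hc
  obtain ⟨z₀, hz₀⟩ := lowerFace_finset_nonempty ⟨y, hyT⟩ u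
  obtain ⟨x, hx, hxmin⟩ := (T.filter fun z => l z.1 < c).exists_min_image
    (fun z => (u z - u z₀) / (c - l z.1)) ⟨y, Finset.mem_filter.2 ⟨hyT, hy⟩⟩
  obtain ⟨hxT, hxc⟩ := Finset.mem_filter.1 hx
  set t : ℝ := (u x - u z₀) / (c - l x.1)
  have hxc' : 0 < c - l x.1 := sub_pos.2 hxc
  have ht0 : 0 ≤ t := div_nonneg (sub_nonneg.2 (hz₀.2 x hxT)) hxc'.le
  have htx : t * (c - l x.1) = u x - u z₀ := div_mul_cancel₀ _ hxc'.ne'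
  let u' : ((Fin d → ℝ) × ℝ) →ₗ[ℝ] ℝ := u + t • (l ∘ₗ LinearMap.fst ℝ (Fin d → ℝ) ℝ)
  have hu' : ∀ z, u' z = u z + t * l z.1 := fun z => by simp [u']
  have hge : ∀ z ∈ T, u z₀ + t * c ≤ u' z := by
    intro z hz
    rw [hu']
    have hz' := hz₀.2 z hz
    by_cases hzc : l z.1 < c
    · have h := hxmin z (Finset.mem_filter.2 ⟨hz, hzc⟩)
      rw [le_div_iff₀ (sub_pos.2 hzc)] at h
      linarith
    · have := mul_le_mul_of_nonneg_left (not_lt.1 hzc) ht0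
      linarith
  refine ⟨u', ?_, ?_, ?_⟩
  · have : u' (0, 1) = u (0, 1) := by simp [hu']
    rw [IsLowerFn, this]
    exact hu
  · intro z hz
    refine ⟨hz.1, fun y hy => le_trans ?_ (hge y hy)⟩
    rw [hu', hl z hz]
    linarith [hz.2 z₀ hz₀.1]
  · intro h
    have hxF : x ∈ lowerFace (T : Set _) u' := by
      refine ⟨hxT, fun y hy => le_trans ?_ (hge y hy)⟩
      rw [hu']
      linarith
    exact hxc.ne (hl x (h hxF))

lemma finrank_vectorSpan_image_fst {u : ((Fin d → ℝ) × ℝ) →ₗ[ℝ] ℝ} (hu : IsLowerFn u)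
    {s : Set ((Fin d → ℝ) × ℝ)} (hs : ∀ z ∈ s, ∀ y ∈ s, u z = u y) :
    Module.finrank ℝ (vectorSpan ℝ (Prod.fst '' s)) = Module.finrank ℝ (vectorSpan ℝ s) := by
  have hmap : vectorSpan ℝ (Prod.fst '' s) =
      (vectorSpan ℝ s).map (LinearMap.fst ℝ (Fin d → ℝ) ℝ) :=
    ((LinearMap.fst ℝ (Fin d → ℝ) ℝ).toAffineMap.map_vectorSpan).symm
  have hker : vectorSpan ℝ s ≤ LinearMap.ker u := by
    rw [vectorSpan, Submodule.span_le]
    rintro _ ⟨z, hz, y, hy, rfl⟩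
    simp [hs z hz y hy]
  rw [hmap, ← LinearMap.range_domRestrict]
  refine LinearMap.finrank_range_of_inj (LinearMap.ker_eq_bot.1 (LinearMap.ker_eq_bot'.2 ?_))
  rintro ⟨⟨x, r⟩, hz⟩ hx
  have hx0 : x = 0 := hx
  subst hx0
  have h : u (r • ((0 : Fin d → ℝ), (1 : ℝ))) = 0 := by
    simpa using LinearMap.mem_ker.1 (hker hz)
  rw [map_smul, smul_eq_mul] at h
  have hr : r = 0 := (mul_eq_zero.1 h).resolve_right (ne_of_gt hu)
  subst hr
  rfl

/-- Every lower face of a polytope is contained in a lower facet. -/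
lemma exists_isLowerFacet_superset {T : Finset ((Fin d → ℝ) × ℝ)} (hT : T.Nonempty)
    {u : ((Fin d → ℝ) × ℝ) →ₗ[ℝ] ℝ} (hu : IsLowerFn u) :
    ∃ G, IsLowerFacet (convexHull ℝ (T : Set _)) G ∧ lowerFace (convexHull ℝ (T : Set _)) u ⊆ G := by
  let S : Set (Set ((Fin d → ℝ) × ℝ)) := {F | ∃ u', IsLowerFn u' ∧ F = lowerFace (T : Set _) u'}
  have hSfin : S.Finite := by
    refine T.finite_toSet.finite_subsets.subset ?_
    rintro _ ⟨u', -, rfl⟩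
    exact lowerFace_subset _ u'
  obtain ⟨_, hle, ⟨u', hu', rfl⟩, hmax⟩ := hSfin.exists_le_maximal ⟨u, hu, rfl⟩
  refine ⟨_, ⟨u', hu', rfl, ?_⟩, ?_⟩
  swap
  · rw [lowerFace_convexHull, lowerFace_convexHull]
    exact convexHull_mono hle
  have hne := lowerFace_finset_nonempty hT u'
  have himg : Prod.fst '' convexHull ℝ (T : Set ((Fin d → ℝ) × ℝ)) =
      convexHull ℝ (Prod.fst '' (T : Set ((Fin d → ℝ) × ℝ))) :=
    (LinearMap.fst ℝ (Fin d → ℝ) ℝ).image_convexHull _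
  rw [himg, (convex_convexHull ℝ _).convexHull_eq, lowerFace_convexHull, setDim_convexHull hne,
    setDim_convexHull (hT.to_set.image _), ← finrank_vectorSpan_image_fst hu'
      fun z hz y hy => le_antisymm (hz.2 y hy.1) (hy.2 z hz.1)]
  have hsub : vectorSpan ℝ (Prod.fst '' lowerFace (T : Set _) u') ≤
      vectorSpan ℝ (Prod.fst '' (T : Set ((Fin d → ℝ) × ℝ))) :=
    vectorSpan_mono ℝ (Set.image_mono (lowerFace_subset _ u'))
  rcases hsub.eq_or_lt with h | h
  · rw [h]
  exfalso
  obtain ⟨x, hxT, hx⟩ := SetLike.exists_of_lt h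
  obtain ⟨l, hlx, hl⟩ := Submodule.exists_le_ker_of_notMem hx
  obtain ⟨z₀, hz₀⟩ := hne
  have hconst : ∀ z ∈ lowerFace (T : Set _) u', l z.1 = l z₀.1 := by
    intro z hz
    have := hl (vsub_mem_vectorSpan ℝ (Set.mem_image_of_mem Prod.fst hz)
      (Set.mem_image_of_mem Prod.fst hz₀))
    simpa [sub_eq_zero] using this
  obtain ⟨y, hyT, hy⟩ : ∃ y ∈ T, l y.1 ≠ l z₀.1 := by
    by_contra! hcon
    have hle : vectorSpan ℝ (Prod.fst '' (T : Set ((Fin d → ℝ) × ℝ))) ≤ LinearMap.ker l := by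
      rw [vectorSpan, Submodule.span_le]
      rintro _ ⟨_, ⟨a, ha, rfl⟩, _, ⟨b, hb, rfl⟩, rfl⟩
      simp [hcon a ha, hcon b hb]
    exact hlx (hle hxT)
  obtain ⟨u'', hu'', hss⟩ : ∃ u'', IsLowerFn u'' ∧
      lowerFace (T : Set _) u' ⊂ lowerFace (T : Set _) u'' := by
    rcases hy.lt_or_gt with hlt | hgt
    · exact exists_lowerFace_ssubset hu' hconst ⟨y, hyT, hlt⟩
    · refine exists_lowerFace_ssubset (l := -l) (c := -l z₀.1) hu' (fun z hz => ?_) ⟨y, hyT, ?_⟩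
      · simp [hconst z hz]
      · simpa using hgt
  exact hss.2 (hmax ⟨u'', hu'', rfl⟩ hss.1)

/-- An exposed face of a simplex is a simplex. -/
lemma IsSimplex.lowerFace {G : Set ((Fin d → ℝ) × ℝ)} (hG : IsSimplex G)
    (u : ((Fin d → ℝ) × ℝ) →ₗ[ℝ] ℝ) : IsSimplex (lowerFace G u) := by
  classical
  obtain ⟨t, ht, rfl⟩ := hG
  refine ⟨t.filter fun z => ∀ y ∈ t, u z ≤ u y, ?_, ?_⟩
  · exact ht.mono (Finset.coe_subset.2 (Finset.filter_subset _ t))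
  · rw [lowerFace_convexHull]
    congr 1
    ext z
    simp [_root_.lowerFace]

/-- A pyramid over a simplex is a simplex. -/
lemma IsSimplex.convexHull_insert {V : Type*} [AddCommGroup V] [Module ℝ V] {F : Set V}
    (hF : IsSimplex F) {p : V} (hp : p ∉ affineSpan ℝ F) : IsSimplex (convexHull ℝ (insert p F)) := by
  classical
  obtain ⟨t, ht, rfl⟩ := hF
  rw [affineSpan_convexHull] at hp
  refine ⟨insert p t, ?_, ?_⟩
  · let i : ((insert p t : Finset V) : Set V) := ⟨p, by simp⟩
    have hmem : ∀ y : {y // y ≠ i}, y.1.1 ∈ (t : Set V) := fun y =>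
      (Finset.mem_insert.1 y.1.2).resolve_left fun h => y.2 (Subtype.ext h)
    refine AffineIndependent.affineIndependent_of_notMem_span (i := i) ?_ fun h => hp ?_
    · let e : {y // y ≠ i} ↪ (t : Set V) :=
        ⟨fun y => ⟨y.1.1, hmem y⟩, fun a b hab =>
          Subtype.ext (Subtype.ext (congrArg (fun q : (t : Set V) => q.1) hab))⟩
      exact ht.comp_embedding e
    · refine affineSpan_mono ℝ ?_ h
      rintro _ ⟨y, hy, rfl⟩
      exact hmem ⟨y, hy⟩
  · rw [Set.insert_eq, convexHull_convexHull_union_right, Finset.coe_insert, Set.insert_eq]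

/-- Above any point there is a height beyond which every lower face of a polytope is exposed by
a functional that is not minimal there. -/
lemma exists_height_forall_lowerFace (T : Finset ((Fin d → ℝ) × ℝ)) (x : Fin d → ℝ) :
    ∃ B : ℝ, ∀ W, B < W → ∀ u, IsLowerFn u → ∃ u', IsLowerFn u' ∧
      lowerFace (T : Set _) u' = lowerFace (T : Set _) u ∧
      ∀ z ∈ lowerFace (T : Set _) u', u' z < u' (x, W) := by
  classical
  let S : Set (Set ((Fin d → ℝ) × ℝ)) := {F | ∃ u', IsLowerFn u' ∧ lowerFace (T : Set _) u' = F}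
  have hSfin : S.Finite := by
    refine T.finite_toSet.finite_subsets.subset ?_
    rintro _ ⟨u', -, rfl⟩
    exact lowerFace_subset _ u'
  have hbound : ∀ F ∈ S, ∃ B : ℝ, ∀ W, B < W → ∃ u', IsLowerFn u' ∧
      lowerFace (T : Set _) u' = F ∧ ∀ z ∈ lowerFace (T : Set _) u', u' z < u' (x, W) := by
    rintro _ ⟨u, hu, rfl⟩
    rcases (lowerFace (T : Set _) u).eq_empty_or_nonempty with h | ⟨z₀, hz₀⟩
    · exact ⟨0, fun W _ => ⟨u, hu, rfl, by simp [h]⟩⟩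
    · refine ⟨(u z₀ - u (x, 0)) / u (0, 1), fun W hW => ⟨u, hu, rfl, fun z hz => ?_⟩⟩
      rw [div_lt_iff₀ hu] at hW
      have hxW : u (x, W) = u (x, 0) + W * u (0, 1) := by
        rw [← smul_eq_mul, ← map_smul, ← map_add]
        simp
      have := hz.2 z₀ hz₀.1
      linarith
  choose! B hB using hbound
  obtain ⟨M, hM⟩ := (hSfin.image B).bddAbove
  refine ⟨M, fun W hW u hu => ?_⟩
  exact hB _ ⟨u, hu, rfl⟩ W ((hM ⟨_, ⟨u, hu, rfl⟩, rfl⟩).trans_lt hW)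

lemma lowerFace_insert_of_lt {s : Set ((Fin d → ℝ) × ℝ)} {p : (Fin d → ℝ) × ℝ}
    {u : ((Fin d → ℝ) × ℝ) →ₗ[ℝ] ℝ} (hne : (lowerFace s u).Nonempty)
    (h : ∀ z ∈ lowerFace s u, u z < u p) : lowerFace (insert p s) u = lowerFace s u := by
  obtain ⟨z₀, hz₀⟩ := hne
  have hlt := h z₀ hz₀
  ext z
  constructor
  · rintro ⟨rfl | hz, hmin⟩
    · exact absurd (hmin z₀ (Or.inr hz₀.1)) (not_le.2 hlt)
    · exact ⟨hz, fun y hy => hmin y (Or.inr hy)⟩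
  · intro hz
    refine ⟨Or.inr hz.1, ?_⟩
    rintro y (rfl | hy)
    · exact (h z hz).le
    · exact hz.2 y hy

/-- Adding an apex off the affine hulls of the lower faces of a polytope whose lower facets are
simplices creates only simplices as lower faces. -/
lemma isSimplex_lowerFace_insert {T : Finset ((Fin d → ℝ) × ℝ)} (hT : T.Nonempty)
    {p : (Fin d → ℝ) × ℝ}
    (hreg : ∀ F, IsLowerFacet (convexHull ℝ (T : Set ((Fin d → ℝ) × ℝ))) F → IsSimplex F)
    (hp : ∀ u : ((Fin d → ℝ) × ℝ) →ₗ[ℝ] ℝ, IsLowerFn u →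
      p ∉ affineSpan ℝ (lowerFace (T : Set _) u))
    {u : ((Fin d → ℝ) × ℝ) →ₗ[ℝ] ℝ} (hu : IsLowerFn u) :
    IsSimplex (lowerFace (convexHull ℝ (insert p (T : Set _))) u) := by
  classical
  have hface : IsSimplex (lowerFace (convexHull ℝ (T : Set _)) u) := by
    obtain ⟨G, hG, hsub⟩ := exists_isLowerFacet_superset hT hu
    have hGQ : G ⊆ convexHull ℝ (T : Set _) := by
      obtain ⟨u', -, rfl, -⟩ := hG
      exact lowerFace_subset _ u'
    rw [lowerFace_eq_of_subset ?_ hGQ hsub]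
    · exact (hreg G hG).lowerFace u
    · rw [lowerFace_convexHull]
      exact (lowerFace_finset_nonempty hT u).convexHull
  obtain ⟨z₀, hz₀⟩ := lowerFace_finset_nonempty hT u
  rw [← Finset.coe_insert, lowerFace_convexHull, Finset.coe_insert]
  rcases lt_trichotomy (u z₀) (u p) with h | h | h
  · rw [lowerFace_insert_of_lt ⟨z₀, hz₀⟩ fun z hz => (hz.2 z₀ hz₀.1).trans_lt h,
      ← lowerFace_convexHull]
    exact hface
  · have heq : lowerFace (insert p (T : Set _)) u = insert p (lowerFace (T : Set _) u) := by
      ext z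
      constructor
      · rintro ⟨rfl | hz, hmin⟩
        · exact Or.inl rfl
        · exact Or.inr ⟨hz, fun y hy => hmin y (Or.inr hy)⟩
      · rintro (rfl | hz)
        · refine ⟨Or.inl rfl, ?_⟩
          rintro y (rfl | hy)
          · exact le_rfl
          · exact h ▸ hz₀.2 y hy
        · refine ⟨Or.inr hz.1, ?_⟩
          rintro y (rfl | hy)
          · exact h ▸ hz.2 z₀ hz₀.1
          · exact hz.2 y hy
    rw [heq, Set.insert_eq, ← convexHull_convexHull_union_right, ← Set.insert_eq,
      ← lowerFace_convexHull]
    refine hface.convexHull_insert ?_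
    rw [lowerFace_convexHull, affineSpan_convexHull]
    exact hp u hu
  · have heq : lowerFace (insert p (T : Set _)) u = {p} := by
      ext z
      constructor
      · rintro ⟨rfl | hz, hmin⟩
        · rfl
        · exact absurd (hmin p (Or.inl rfl)) (not_le.2 (h.trans_le (hz₀.2 z hz)))
      · rintro rfl
        refine ⟨Or.inl rfl, ?_⟩
        rintro y (rfl | hy)
        · exact le_rfl
        · exact (h.trans_le (hz₀.2 y hy)).le
    rw [heq]
    refine ⟨{p}, ?_, by simp⟩
    rw [Finset.coe_singleton]
    exact affineIndependent_of_subsingleton ℝ _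

lemma notMem_affineSpan_of_lt {V : Type*} [AddCommGroup V] [Module ℝ V] {s : Set V} {p : V}
    {f : V →ₗ[ℝ] ℝ} (hs : ∀ z ∈ s, ∀ y ∈ s, f z = f y) (h : ∀ z ∈ s, f z < f p) :
    p ∉ affineSpan ℝ s := by
  intro hp
  obtain ⟨z₀, hz₀⟩ := (affineSpan_nonempty ℝ).1 ⟨p, hp⟩
  have hker : vectorSpan ℝ s ≤ LinearMap.ker f := by
    rw [vectorSpan, Submodule.span_le]
    rintro _ ⟨z, hz, y, hy, rfl⟩
    simp [hs z hz y hy]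
  have := hker (vsub_mem_vectorSpan_of_mem_affineSpan_of_mem_affineSpan hp
    (mem_affineSpan ℝ hz₀))
  exact (h z₀ hz₀).ne' (by simpa [sub_eq_zero] using this)

end LowerFaces

lemma image_fst_liftQ {d : ℕ} (L : Finset (Fin d → ℚ)) (w : (Fin d → ℚ) → ℚ) :
    Prod.fst '' liftQ L w = convexHull ℝ (rk '' (L : Set (Fin d → ℚ))) := by
  have : Prod.fst '' liftQ L w =
      convexHull ℝ (Prod.fst '' ((fun x => (rk x, (w x : ℝ))) '' (L : Set (Fin d → ℚ)))) :=
    (LinearMap.fst ℝ (Fin d → ℝ) ℝ).image_convexHull _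
  rw [this, Set.image_image]

/-- Let `L₀ ⊆ ℚ^d` be finite, `v ∈ ℚ^d` with `dim conv (L₀ ∪ {v}) = dim conv L₀`, and `w₀` a
nonnegative rational weight on `L₀` such that every lower facet of `Q_{w₀}` is a simplex. Then there
is `W ∈ ℚ≥0` and a weight `w₁` on `L₀ ∪ {v}` with `w₁ = w₀` on `L₀` and `w₁ v = W` (for `v ∈ L₀` this
means `W = w₀ v`) such that every lower facet of `Q_{w₁}` is a simplex and every lower facet of
`Q_{w₀}` is a lower facet of `Q_{w₁}`. -/
theorem stmt1 (d : ℕ) (L₀ : Finset (Fin d → ℚ)) (v : Fin d → ℚ)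
    (hdim : setDim (convexHull ℝ (rk '' ((insert v L₀ : Finset (Fin d → ℚ)) : Set (Fin d → ℚ)))) =
            setDim (convexHull ℝ (rk '' (L₀ : Set (Fin d → ℚ)))))
    (w₀ : (Fin d → ℚ) → ℚ) (hw₀ : ∀ x ∈ L₀, 0 ≤ w₀ x)
    (hreg : ∀ F, IsLowerFacet (liftQ L₀ w₀) F → IsSimplex F) :
    ∃ W : ℚ, 0 ≤ W ∧
      ∃ w₁ : (Fin d → ℚ) → ℚ, (∀ x ∈ L₀, w₁ x = w₀ x) ∧ w₁ v = W ∧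
        (∀ F, IsLowerFacet (liftQ (insert v L₀) w₁) F → IsSimplex F) ∧
        (∀ F, IsLowerFacet (liftQ L₀ w₀) F → IsLowerFacet (liftQ (insert v L₀) w₁) F) := by
  classical
  have hne : L₀.Nonempty := by
    rw [Finset.nonempty_iff_ne_empty]
    rintro rfl
    simp [setDim] at hdim
  by_cases hv : v ∈ L₀
  · rw [Finset.insert_eq_of_mem hv]
    exact ⟨w₀ v, hw₀ v hv, w₀, fun _ _ => rfl, rfl, hreg, fun _ hF => hF⟩
  let T : Finset ((Fin d → ℝ) × ℝ) := L₀.image fun x => (rk x, (w₀ x : ℝ))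
  have hT : T.Nonempty := hne.image _
  have hQ₀ : liftQ L₀ w₀ = convexHull ℝ (T : Set _) := by simp [liftQ, T]
  obtain ⟨B, hB⟩ := exists_height_forall_lowerFace T (rk v)
  obtain ⟨W, hW⟩ := exists_rat_gt (max B 0)
  have hW0 : (0 : ℚ) ≤ W := by exact_mod_cast ((le_max_right B 0).trans_lt hW).le
  have hB' := hB W ((le_max_left B 0).trans_lt hW)
  have hw₁ : ∀ x ∈ L₀, Function.update w₀ v W x = w₀ x := fun x hx =>
    Function.update_of_ne (ne_of_mem_of_not_mem hx hv) _ _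
  have hQ₁ : liftQ (insert v L₀) (Function.update w₀ v W) =
      convexHull ℝ (insert (rk v, (W : ℝ)) (T : Set _)) := by
    rw [liftQ, Finset.coe_insert, Set.image_insert_eq, Function.update_self, Finset.coe_image]
    congr 2
    exact Set.image_congr fun x hx => by rw [hw₁ x hx]
  refine ⟨W, hW0, Function.update w₀ v W, hw₁, Function.update_self .., ?_, ?_⟩
  · rintro _ ⟨u, hu, rfl, -⟩
    rw [hQ₁]
    refine isSimplex_lowerFace_insert hT (hQ₀ ▸ hreg) (fun u hu => ?_) hu
    obtain ⟨u', -, heq, hlt⟩ := hB' u hu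
    rw [← heq]
    exact notMem_affineSpan_of_lt
      (fun z hz y hy => le_antisymm (hz.2 y hy.1) (hy.2 z hz.1)) hlt
  · rintro _ ⟨u, hu, rfl, hF⟩
    obtain ⟨u', hu', heq, hlt⟩ := hB' u hu
    refine ⟨u', hu', ?_, ?_⟩
    · rw [hQ₀, hQ₁, ← Finset.coe_insert, lowerFace_convexHull, lowerFace_convexHull,
        Finset.coe_insert, lowerFace_insert_of_lt (lowerFace_finset_nonempty hT u') hlt, heq]
    · rw [hF, image_fst_liftQ, image_fst_liftQ, (convex_convexHull ℝ _).convexHull_eq,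
        (convex_convexHull ℝ _).convexHull_eq, hdim]
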